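/- Let N ≥ 6 be even with N ≡ 2 (mod 4), let n = N−1, and let λ ∈ {−1,1}^N satisfy λ_1 + ⋯ + λ_N = 0. Then there exists a nonzero polynomial p in the variables (c_1,…,c_n, a, entries of an n×n matrix R) such that for every c ∈ ℂ^n, a ∈ ℂ∖{0}, and invertible complex n×n matrix R with p(c, a, R) ≠ 0, the facet subsystem determined by (c, a, R, V(λ)) has exactly N/2 solutions x ∈ (ℂ∖{0})^n. -/

import Mathlib

noncomputable section

/-- The monomial `x^v = ∏_j x_j^{v_j}` (integer exponents). -/
def mpow {n : ℕ} (x : Fin n → ℂ) (v : Fin n → ℤ) : ℂ := ∏ j, x j ^ v j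

/-- The facet matrix `V(λ)`: its `k`-th column (`k = 1, …, N`) is `λ_k (e_{k-1} − e_k)`,
with `e_0 = e_N = 0`. -/
def facetV (N : ℕ) (lam : Fin N → ℤ) : Matrix (Fin (N - 1)) (Fin N) ℤ :=
  Matrix.of fun r k =>
    lam k * ((if (r : ℕ) + 1 = (k : ℕ) then 1 else 0) - (if (r : ℕ) = (k : ℕ) then 1 else 0))

/-- The set of solutions `x ∈ (ℂ∖{0})^{N-1}` of the facet subsystem
`c_i = a ∑_{k=1}^N (RV)_{ik} x^{v_k}`, `i = 1, …, N-1`, determined by `(c, a, R, V(λ))`. -/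
def facetSol (N : ℕ) (c : Fin (N - 1) → ℂ) (a : ℂ)
    (R : Matrix (Fin (N - 1)) (Fin (N - 1)) ℂ) (lam : Fin N → ℤ) :
    Set (Fin (N - 1) → ℂ) :=
  {x | (∀ j, x j ≠ 0) ∧
    ∀ i, c i = a * ∑ k, (∑ r, R i r * (facetV N lam r k : ℂ)) *
      mpow x (fun r => facetV N lam r k)}

/-- The ratios `x_{k-1} / x_k` of consecutive coordinates, with `x_{-1} = x_n = 1`. -/
def consRatio {n : ℕ} (x : Fin n → ℂ) (k : Fin (n + 1)) : ℂ :=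
  (Fin.cons 1 x : Fin (n + 1) → ℂ) k / (Fin.snoc x 1 : Fin (n + 1) → ℂ) k

lemma cons_one_ne_zero {n : ℕ} {x : Fin n → ℂ} (hx : ∀ j, x j ≠ 0) (k : Fin (n + 1)) :
    (Fin.cons 1 x : Fin (n + 1) → ℂ) k ≠ 0 := by
  cases k using Fin.cases <;> simp [hx]

lemma snoc_one_ne_zero {n : ℕ} {x : Fin n → ℂ} (hx : ∀ j, x j ≠ 0) (k : Fin (n + 1)) :
    (Fin.snoc x 1 : Fin (n + 1) → ℂ) k ≠ 0 := by
  cases k using Fin.lastCases <;> simp [hx]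

lemma consRatio_ne_zero {n : ℕ} {x : Fin n → ℂ} (hx : ∀ j, x j ≠ 0) (k : Fin (n + 1)) :
    consRatio x k ≠ 0 :=
  div_ne_zero (cons_one_ne_zero hx k) (snoc_one_ne_zero hx k)

lemma prod_consRatio {n : ℕ} {x : Fin n → ℂ} (hx : ∀ j, x j ≠ 0) :
    ∏ k, consRatio x k = 1 := by
  have h : ∏ j, x j ≠ 0 := Finset.prod_ne_zero_iff.mpr fun j _ => hx j
  simp only [consRatio, Finset.prod_div_distrib]
  rw [Fin.prod_univ_succ, Fin.prod_univ_castSucc (f := (Fin.snoc x 1 : Fin (n + 1) → ℂ))]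
  simp [div_self h]

lemma consRatio_injOn {n : ℕ} : Set.InjOn (consRatio (n := n)) {x | ∀ j, x j ≠ 0} := by
  intro x hx y hy h
  have key : ∀ k : Fin (n + 1), (Fin.cons 1 x : Fin (n + 1) → ℂ) k = (Fin.cons 1 y : _ → ℂ) k := by
    intro k
    induction k using Fin.induction with
    | zero => simp
    | succ j ih =>
      have hj := congrFun h j.castSucc
      simp only [consRatio, ih, Fin.snoc_castSucc] at hj
      simpa [div_eq_mul_inv, cons_one_ne_zero hy] using hj
  funext j
  simpa using key j.succ

lemma exists_consRatio_eq {n : ℕ} (y : Fin (n + 1) → ℂ) (hy : ∏ k, y k = 1) :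
    ∃ x : Fin n → ℂ, (∀ j, x j ≠ 0) ∧ consRatio x = y := by
  have hy0 : ∀ k, y k ≠ 0 := fun k =>
    Finset.prod_ne_zero_iff.mp (hy ▸ one_ne_zero) k (Finset.mem_univ k)
  have hp : ∀ k, Fin.partialProd y k ≠ 0 := by
    intro k
    induction k using Fin.induction with
    | zero => simp
    | succ j ih => rw [Fin.partialProd_succ]; exact mul_ne_zero ih (hy0 j)
  have hlast : Fin.partialProd y (Fin.last (n + 1)) = 1 := by
    rw [← hy, Fin.partialProd, ← List.prod_ofFn, List.take_of_length_le (by simp)]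
  refine ⟨fun j => (Fin.partialProd y j.succ.castSucc)⁻¹, fun j => inv_ne_zero (hp _), ?_⟩
  funext k
  have h1 : (Fin.cons 1 (fun j : Fin n => (Fin.partialProd y j.succ.castSucc)⁻¹) :
      Fin (n + 1) → ℂ) k = (Fin.partialProd y k.castSucc)⁻¹ := by
    cases k using Fin.cases <;> simp
  have h2 : (Fin.snoc (fun j : Fin n => (Fin.partialProd y j.succ.castSucc)⁻¹) 1 :
      Fin (n + 1) → ℂ) k = (Fin.partialProd y k.succ)⁻¹ := by
    cases k using Fin.lastCases with
    | last => simp [hlast]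
    | cast j => simp
  rw [consRatio, h1, h2, Fin.partialProd_succ, inv_div_inv,
    mul_div_cancel_left₀ _ (hp _)]

lemma mpow_facetV {n : ℕ} (lam : Fin (n + 1) → ℤ) {x : Fin n → ℂ} (hx : ∀ j, x j ≠ 0)
    (k : Fin (n + 1)) :
    mpow x (fun r => facetV (n + 1) lam r k) = consRatio x k ^ lam k := by
  have h1 : ∏ j : Fin n, x j ^ (if (j : ℕ) + 1 = (k : ℕ) then 1 else 0 : ℤ) =
      (Fin.cons 1 x : Fin (n + 1) → ℂ) k := by
    cases k using Fin.cases with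
    | zero => simp
    | succ i =>
      rw [Finset.prod_eq_single i] <;> simp +contextual [Fin.val_inj]
  have h2 : ∏ j : Fin n, x j ^ (if (j : ℕ) = (k : ℕ) then 1 else 0 : ℤ) =
      (Fin.snoc x 1 : Fin (n + 1) → ℂ) k := by
    cases k using Fin.lastCases with
    | last => simpa using Finset.prod_eq_one fun j _ => by simp [j.isLt.ne]
    | cast i =>
      rw [Finset.prod_eq_single i] <;> simp +contextual [Fin.val_inj]
  rw [consRatio, ← h1, ← h2, ← Finset.prod_div_distrib, ← Finset.prod_zpow]
  refine Finset.prod_congr rfl fun j _ => ?_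
  rw [← zpow_sub₀ (hx j), ← zpow_mul, mul_comm]
  rfl

lemma facetV_mulVec {n : ℕ} (lam : Fin (n + 1) → ℤ) (m : Fin (n + 1) → ℂ) (r : Fin n) :
    ∑ k, (facetV (n + 1) lam r k : ℂ) * m k =
      lam r.succ * m r.succ - lam r.castSucc * m r.castSucc := by
  have h : ∀ k : Fin (n + 1), (facetV (n + 1) lam r k : ℂ) * m k =
      (if r.succ = k then lam k * m k else 0) - (if r.castSucc = k then lam k * m k else 0) := by
    intro k
    simp only [facetV, Matrix.of_apply, Fin.ext_iff, Fin.val_succ, Fin.val_castSucc]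
    push_cast
    split_ifs <;> simp
  simp [h, Finset.sum_sub_distrib]

lemma eq_add_partialSum_iff {A : Type*} [AddCommGroup A] {n : ℕ} (d : Fin n → A)
    (u : Fin (n + 1) → A) :
    (∀ k, u k = u 0 + Fin.partialSum d k) ↔ ∀ j : Fin n, d j = u j.succ - u j.castSucc := by
  constructor
  · intro h j
    rw [h j.succ, h j.castSucc, Fin.partialSum_succ]
    abel
  · intro h k
    induction k using Fin.induction with
    | zero => simp
    | succ j ih => rw [Fin.partialSum_succ, ← add_assoc, ← ih, h]; abel

/-- Multiplying the facet subsystem by the adjugate of `R` decouples it into a chain of equations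
between consecutive monomials. -/
lemma mem_facetSol_iff {n : ℕ} (lam : Fin (n + 1) → ℤ) (c : Fin n → ℂ) (a : ℂ)
    (R : Matrix (Fin n) (Fin n) ℂ) (hR : R.det ≠ 0) (x : Fin n → ℂ) :
    x ∈ facetSol (n + 1) c a R lam ↔ (∀ j, x j ≠ 0) ∧
      ∀ k, a * R.det * (lam k * consRatio x k ^ lam k) =
        a * R.det * (lam 0 * consRatio x 0 ^ lam 0) +
          Fin.partialSum (R.adjugate.mulVec c) k := by
  refine and_congr_right fun hx => ?_
  rw [eq_add_partialSum_iff (R.adjugate.mulVec c)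
    (fun k => a * R.det * (lam k * consRatio x k ^ lam k))]
  set w : Fin n → ℂ := fun r => lam r.succ * consRatio x r.succ ^ lam r.succ -
    lam r.castSucc * consRatio x r.castSucc ^ lam r.castSucc with hw
  have hsys : (fun i => a * ∑ k, (∑ r, R i r * (facetV (n + 1) lam r k : ℂ)) *
      mpow x (fun r => facetV (n + 1) lam r k)) = a • R.mulVec w := by
    funext i
    simp only [Pi.smul_apply, smul_eq_mul, Matrix.mulVec, dotProduct, hw]
    congr 1
    simp_rw [← facetV_mulVec lam (fun k => consRatio x k ^ lam k), Finset.mul_sum, Finset.sum_mul]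
    rw [Finset.sum_comm]
    refine Finset.sum_congr rfl fun r _ => Finset.sum_congr rfl fun k _ => ?_
    rw [mpow_facetV lam hx, mul_assoc]
  have h1 : (∀ i, c i = a * ∑ k, (∑ r, R i r * (facetV (n + 1) lam r k : ℂ)) *
      mpow x (fun r => facetV (n + 1) lam r k)) ↔ c = a • R.mulVec w := by
    rw [← hsys, funext_iff]
  have h2 : (∀ j : Fin n, R.adjugate.mulVec c j =
      a * R.det * (lam j.succ * consRatio x j.succ ^ lam j.succ) -
      a * R.det * (lam j.castSucc * consRatio x j.castSucc ^ lam j.castSucc)) ↔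
      R.adjugate.mulVec c = (a * R.det) • w := by
    rw [funext_iff]
    simp [hw, mul_sub]
  refine h1.trans (Iff.trans ⟨fun h => ?_, fun h => ?_⟩ h2.symm)
  · rw [h, Matrix.mulVec_smul, Matrix.mulVec_mulVec, Matrix.adjugate_mul, Matrix.smul_mulVec,
      Matrix.one_mulVec, smul_smul]
  · have := congrArg R.mulVec h
    rw [Matrix.mulVec_mulVec, Matrix.mul_adjugate, Matrix.smul_mulVec, Matrix.one_mulVec,
      mul_comm, mul_smul, Matrix.mulVec_smul, Matrix.mulVec_smul] at this
    exact smul_right_injective _ hR this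

section FacetPolynomial

open Polynomial

variable {A B : Type*} [CommRing A] [CommRing B] {N : ℕ}

/-- The product of the linear forms `X + D k` over the indices `k` of sign `ε`. -/
def signProd (lam : Fin N → ℤ) (ε : ℤ) (D : Fin N → A) : A[X] :=
  ∏ k with lam k = ε, (X + C (D k))

/-- The univariate polynomial whose roots parametrize the solutions of the facet subsystem. -/
def facetPoly (lam : Fin N → ℤ) (D : Fin N → A) : A[X] :=
  signProd lam 1 D + signProd lam (-1) D

/-- The resultant which is nonzero exactly when `facetPoly lam D` has only simple roots, none of
them of the form `-D k`. -/
def facetResultant (lam : Fin N → ℤ) (m : ℕ) (D : Fin N → A) : A :=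
  resultant (facetPoly lam D) (derivative (facetPoly lam D) * signProd lam 1 D) m (m - 1 + m)

lemma signProd_map (φ : A →+* B) (lam : Fin N → ℤ) (ε : ℤ) (D : Fin N → A) :
    (signProd lam ε D).map φ = signProd lam ε (φ ∘ D) := by
  simp [signProd, Polynomial.map_prod]

lemma facetPoly_map (φ : A →+* B) (lam : Fin N → ℤ) (D : Fin N → A) :
    (facetPoly lam D).map φ = facetPoly lam (φ ∘ D) := by
  simp [facetPoly, signProd_map]

lemma facetResultant_map (φ : A →+* B) (lam : Fin N → ℤ) (m : ℕ) (D : Fin N → A) :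
    φ (facetResultant lam m D) = facetResultant lam m (φ ∘ D) := by
  rw [facetResultant, ← resultant_map_map, Polynomial.map_mul, ← derivative_map, facetPoly_map,
    signProd_map, facetResultant]

lemma signProd_monic (lam : Fin N → ℤ) (ε : ℤ) (D : Fin N → A) : (signProd lam ε D).Monic :=
  monic_prod_of_monic _ _ fun _ _ => monic_X_add_C _

lemma natDegree_signProd [Nontrivial A] (lam : Fin N → ℤ) (ε : ℤ) (D : Fin N → A) :
    (signProd lam ε D).natDegree = (Finset.univ.filter fun k => lam k = ε).card := by
  rw [signProd, natDegree_prod_of_monic _ _ fun _ _ => monic_X_add_C _]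
  simp

lemma eval_signProd (lam : Fin N → ℤ) (ε : ℤ) (D : Fin N → A) (s : A) :
    (signProd lam ε D).eval s = ∏ k with lam k = ε, (s + D k) := by
  simp [signProd, eval_prod]

variable {m : ℕ} {lam : Fin N → ℤ}

lemma natDegree_facetPoly (hpos : (Finset.univ.filter fun k => lam k = 1).card = m)
    (hneg : (Finset.univ.filter fun k => lam k = -1).card = m) (D : Fin N → ℂ) :
    (facetPoly lam D).natDegree = m := by
  have h1 := natDegree_signProd lam 1 D
  have h2 := natDegree_signProd lam (-1) D
  refine natDegree_eq_of_le_of_coeff_ne_zero (natDegree_add_le_of_degree_le (by lia) (by lia)) ?_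
  have c1 := (signProd_monic lam 1 D).coeff_natDegree
  have c2 := (signProd_monic lam (-1) D).coeff_natDegree
  rw [h1, hpos] at c1
  rw [h2, hneg] at c2
  rw [facetPoly, coeff_add, c1, c2]
  norm_num

lemma facetResultant_ne_zero_iff (hm : m ≠ 0)
    (hpos : (Finset.univ.filter fun k => lam k = 1).card = m)
    (hneg : (Finset.univ.filter fun k => lam k = -1).card = m) (D : Fin N → ℂ) :
    facetResultant lam m D ≠ 0 ↔
      IsCoprime (facetPoly lam D) (derivative (facetPoly lam D) * signProd lam 1 D) := by
  have hd := natDegree_facetPoly hpos hneg D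
  have hQ : facetPoly lam D ≠ 0 := fun h => hm (by simpa [h] using hd.symm)
  have hQ' : derivative (facetPoly lam D) ≠ 0 := fun h =>
    hm (hd ▸ derivative_eq_zero.mp h)
  have hd' : (derivative (facetPoly lam D)).natDegree = m - 1 := by
    rw [natDegree_derivative, hd]
  have hdeg : (derivative (facetPoly lam D) * signProd lam 1 D).natDegree = m - 1 + m := by
    rw [natDegree_mul hQ' (signProd_monic lam 1 D).ne_zero, hd', natDegree_signProd, hpos]
  have := resultant_eq_zero_iff (f := facetPoly lam D)
    (g := derivative (facetPoly lam D) * signProd lam 1 D)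
  rw [hd, hdeg] at this
  rw [facetResultant, Ne, this]
  simp [hQ]

/-- For `D` equal to `α` at the positive signs and to `α + 1` at the negative ones, `facetPoly`
is `(X + α) ^ m + (X + α + 1) ^ m`. -/
lemma facetResultant_ne_zero (hm : m ≠ 0)
    (hpos : (Finset.univ.filter fun k => lam k = 1).card = m)
    (hneg : (Finset.univ.filter fun k => lam k = -1).card = m) (α : ℂ) :
    facetResultant lam m (fun k => (if lam k = 1 then 0 else 1) + α) ≠ 0 := by
  have hP : signProd lam 1 (fun k => (if lam k = 1 then 0 else 1) + α) = (X + C α) ^ m := by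
    rw [signProd, Finset.prod_congr rfl (g := fun _ => X + C α), Finset.prod_const, hpos]
    intro k hk
    simp [(Finset.mem_filter.mp hk).2]
  have hM : signProd lam (-1) (fun k => (if lam k = 1 then 0 else 1) + α) =
      (X + C (1 + α)) ^ m := by
    rw [signProd, Finset.prod_congr rfl (g := fun _ => X + C (1 + α)), Finset.prod_const, hneg]
    intro k hk
    simp [(Finset.mem_filter.mp hk).2]
  rw [facetResultant_ne_zero_iff hm hpos hneg, isCoprime_iff_aeval_ne_zero_of_isAlgClosed ℂ ℂ,
    facetPoly, hP, hM]
  intro z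
  obtain ⟨l, rfl⟩ := Nat.exists_eq_succ_of_ne_zero hm
  by_contra! h
  obtain ⟨h1, h2⟩ := h
  rw [derivative_add, derivative_X_add_C_pow, derivative_X_add_C_pow] at h2
  simp only [Nat.succ_eq_add_one, Nat.add_sub_cancel, map_add, map_mul, map_pow, map_natCast,
    aeval_X, aeval_C, mul_eq_zero, ← mul_add, Algebra.algebraMap_self, RingHom.id_apply,
    show z + (1 + α) = z + α + 1 by ring] at h1 h2
  set u := z + α
  have hu : u ≠ 0 := by
    intro hu
    simp [hu] at h1
  have h3 : u ^ l + (u + 1) ^ l = 0 := by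
    rcases h2 with (h2 | h2) | h2
    · exact absurd h2 (Nat.cast_ne_zero.mpr hm)
    · exact h2
    · exact absurd h2 (pow_ne_zero _ hu)
  have h4 : (u + 1) ^ l = 0 := by linear_combination h1 - u * h3
  rw [h4, add_zero] at h3
  exact pow_ne_zero l hu h3

lemma ncard_rootSet_facetPoly (hpos : (Finset.univ.filter fun k => lam k = 1).card = m)
    (hneg : (Finset.univ.filter fun k => lam k = -1).card = m) (D : Fin N → ℂ)
    (h : IsCoprime (facetPoly lam D) (derivative (facetPoly lam D) * signProd lam 1 D)) :
    ((facetPoly lam D).rootSet ℂ).ncard = m := by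
  rw [← Nat.card_coe_set_eq, Nat.card_eq_fintype_card,
    card_rootSet_eq_natDegree (IsCoprime.of_mul_right_left h) (IsAlgClosed.splits _),
    natDegree_facetPoly hpos hneg]

end FacetPolynomial

section Balanced

variable {N : ℕ} {lam : Fin N → ℤ}

lemma prod_eq_prod_filter_sign {M : Type*} [CommMonoid M] (hlam : ∀ k, lam k = 1 ∨ lam k = -1)
    (f : Fin N → M) :
    ∏ k, f k = (∏ k with lam k = 1, f k) * ∏ k with lam k = -1, f k := by
  rw [← Finset.prod_filter_mul_prod_filter_not Finset.univ (fun k => lam k = 1)]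
  congr 2
  refine Finset.filter_congr fun k _ => ?_
  rcases hlam k with h | h <;> simp [h]

lemma card_filter_sign (hlam : ∀ k, lam k = 1 ∨ lam k = -1) (hsum : ∑ k, lam k = 0) :
    (Finset.univ.filter fun k => lam k = 1).card = N / 2 ∧
      (Finset.univ.filter fun k => lam k = -1).card = N / 2 := by
  have hcard : (Finset.univ.filter fun k => lam k = 1).card +
      (Finset.univ.filter fun k => lam k = -1).card = N := by
    have := prod_eq_prod_filter_sign hlam (fun _ => Multiplicative.ofAdd 1)
    simpa [← ofAdd_nsmul, ← ofAdd_add] using this.symm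
  have hdiff : ((Finset.univ.filter fun k => lam k = 1).card : ℤ) -
      (Finset.univ.filter fun k => lam k = -1).card = 0 := by
    rw [← hsum, Finset.card_filter, Finset.card_filter]
    push_cast
    rw [← Finset.sum_sub_distrib]
    refine Finset.sum_congr rfl fun k _ => ?_
    rcases hlam k with h | h <;> simp [h]
  lia

end Balanced

section Count

variable {n m : ℕ} {lam : Fin (n + 1) → ℤ}

lemma prod_filter_sign_add_prod_filter_sign (hlam : ∀ k, lam k = 1 ∨ lam k = -1)
    (hneg : (Finset.univ.filter fun k => lam k = -1).card = m)
    (hpos : (Finset.univ.filter fun k => lam k = 1).card = m) (hodd : Odd m)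
    {t : ℂ} (ht : t ≠ 0) {y w : Fin (n + 1) → ℂ} (hy : ∀ k, y k ≠ 0)
    (hw : ∀ k, t * (lam k * y k ^ lam k) = w k) :
    (∏ k with lam k = 1, w k) + ∏ k with lam k = -1, w k = 0 ↔ ∏ k, y k = 1 := by
  have h1 : ∏ k with lam k = 1, w k = t ^ m * ∏ k with lam k = 1, y k := by
    rw [← hpos, ← Finset.prod_const, ← Finset.prod_mul_distrib]
    refine Finset.prod_congr rfl fun k hk => ?_
    rw [← hw, (Finset.mem_filter.mp hk).2]
    simp
  have h2 : ∏ k with lam k = -1, w k = -t ^ m * (∏ k with lam k = -1, y k)⁻¹ := by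
    rw [← hodd.neg_pow, ← hneg, ← Finset.prod_const, ← Finset.prod_inv_distrib,
      ← Finset.prod_mul_distrib]
    refine Finset.prod_congr rfl fun k hk => ?_
    rw [← hw, (Finset.mem_filter.mp hk).2]
    simp
  have h3 : ∏ k with lam k = -1, y k ≠ 0 := Finset.prod_ne_zero_iff.mpr fun k _ => hy k
  rw [h1, h2, prod_eq_prod_filter_sign hlam, neg_mul, ← sub_eq_add_neg, sub_eq_zero,
    mul_right_inj' (pow_ne_zero m ht), ← mul_eq_one_iff_eq_inv₀ h3]

lemma signed_zpow_injective {ε : ℤ} (hε : ε = 1 ∨ ε = -1) {t : ℂ} (ht : t ≠ 0) {y z : ℂ}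
    (h : t * (ε * y ^ ε) = t * (ε * z ^ ε)) : y = z := by
  rcases hε with rfl | rfl <;> simpa [ht] using h

lemma exists_signed_zpow_eq {ε : ℤ} (hε : ε = 1 ∨ ε = -1) {t w : ℂ} (ht : t ≠ 0) (hw : w ≠ 0) :
    ∃ y : ℂ, y ≠ 0 ∧ t * (ε * y ^ ε) = w := by
  rcases hε with rfl | rfl
  · exact ⟨w / t, div_ne_zero hw ht, by simp [mul_div_cancel₀, ht]⟩
  · exact ⟨-(t / w), neg_ne_zero.mpr (div_ne_zero ht hw), by simp; field_simp⟩

lemma facetSol_finite_and_ncard (hlam : ∀ k, lam k = 1 ∨ lam k = -1)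
    (hpos : (Finset.univ.filter fun k => lam k = 1).card = m)
    (hneg : (Finset.univ.filter fun k => lam k = -1).card = m) (hodd : Odd m)
    (c : Fin n → ℂ) (a : ℂ) (R : Matrix (Fin n) (Fin n) ℂ) (ha : a ≠ 0) (hR : R.det ≠ 0)
    (hD : facetResultant lam m (Fin.partialSum (R.adjugate.mulVec c)) ≠ 0) :
    (facetSol (n + 1) c a R lam).Finite ∧ (facetSol (n + 1) c a R lam).ncard = m := by
  have ht : a * R.det ≠ 0 := mul_ne_zero ha hR
  have hmem := mem_facetSol_iff lam c a R hR
  generalize a * R.det = t at ht hmem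
  have h0 : Fin.partialSum (R.adjugate.mulVec c) 0 = 0 := Fin.partialSum_zero _
  generalize Fin.partialSum (R.adjugate.mulVec c) = D at hD hmem h0
  rw [facetResultant_ne_zero_iff hodd.pos.ne' hpos hneg] at hD
  have hQ : facetPoly lam D ≠ 0 := fun h =>
    hodd.pos.ne' (by simpa [h] using (natDegree_facetPoly hpos hneg D).symm)
  have hroot : ∀ s, s ∈ (facetPoly lam D).rootSet ℂ ↔
      (∏ k with lam k = 1, (s + D k)) + ∏ k with lam k = -1, (s + D k) = 0 := fun s => by
    rw [Polynomial.mem_rootSet_of_ne hQ, Polynomial.coe_aeval_eq_eval, facetPoly,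
      Polynomial.eval_add, eval_signProd, eval_signProd]
  have hne : ∀ s ∈ (facetPoly lam D).rootSet ℂ, ∀ k, s + D k ≠ 0 := by
    intro s hs k hk
    have hcop := (Polynomial.isCoprime_iff_aeval_ne_zero_of_isAlgClosed ℂ ℂ _ _).mp
      (IsCoprime.of_mul_right_right hD) s
    rw [Polynomial.mem_rootSet_of_ne hQ] at hs
    simp only [hs, ne_eq, not_true_eq_false, false_or, Polynomial.coe_aeval_eq_eval,
      eval_signProd] at hcop
    rw [← Polynomial.mem_rootSet_of_ne hQ, hroot] at hs
    rcases hlam k with h | h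
    · exact hcop (Finset.prod_eq_zero (Finset.mem_filter.mpr ⟨Finset.mem_univ k, h⟩) hk)
    · have hk' : ∏ k with lam k = -1, (s + D k) = 0 :=
        Finset.prod_eq_zero (Finset.mem_filter.mpr ⟨Finset.mem_univ k, h⟩) hk
      exact hcop (by simpa [hk'] using hs)
  let f : (Fin n → ℂ) → ℂ := fun x => t * (lam 0 * consRatio x 0 ^ lam 0)
  have hinj : Set.InjOn f (facetSol (n + 1) c a R lam) := by
    intro x hx x' hx' hxx
    rw [hmem] at hx hx'
    refine consRatio_injOn hx.1 hx'.1 (funext fun k => signed_zpow_injective (hlam k) ht ?_)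
    rw [hx.2 k, hx'.2 k]
    exact congrArg (· + D k) hxx
  have himage : f '' facetSol (n + 1) c a R lam = (facetPoly lam D).rootSet ℂ := by
    ext s
    constructor
    · rintro ⟨x, hx, rfl⟩
      rw [hmem] at hx
      exact (hroot _).mpr <| (prod_filter_sign_add_prod_filter_sign hlam hneg hpos hodd ht
        (consRatio_ne_zero hx.1) hx.2).mpr (prod_consRatio hx.1)
    · intro hs
      choose y hy hys using fun k => exists_signed_zpow_eq (hlam k) ht (hne s hs k)
      obtain ⟨x, hx, rfl⟩ := exists_consRatio_eq y <|
        (prod_filter_sign_add_prod_filter_sign hlam hneg hpos hodd ht hy hys).mp ((hroot s).mp hs)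
      have hf : f x = s := by simpa [h0] using hys 0
      refine ⟨x, (hmem x).mpr ⟨hx, fun k => ?_⟩, hf⟩
      rw [hys k]
      exact congrArg (· + D k) hf.symm
  refine ⟨Set.Finite.of_finite_image (himage ▸ Polynomial.rootSet_finite _ _) hinj, ?_⟩
  rw [← hinj.ncard_image, himage, ncard_rootSet_facetPoly hpos hneg D hD]

end Count

lemma map_partialSum {A B F : Type*} [AddMonoid A] [AddMonoid B] [FunLike F A B]
    [AddMonoidHomClass F A B] (φ : F) {n : ℕ} (d : Fin n → A) :
    φ ∘ Fin.partialSum d = Fin.partialSum (φ ∘ d) := by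
  funext k
  induction k using Fin.induction with
  | zero => simp
  | succ j ih =>
    rw [Function.comp_apply] at ih
    simp [Fin.partialSum_succ, ih]

/-- The facet resultant at the partial sums of `adj(R) c`, as a polynomial in `(c, a, R)`. -/
def genericFacetResultant {n : ℕ} (lam : Fin (n + 1) → ℤ) (m : ℕ) :
    MvPolynomial (Fin n ⊕ Unit ⊕ (Fin n × Fin n)) ℂ :=
  facetResultant lam m <| Fin.partialSum <|
    (Matrix.of fun i j => MvPolynomial.X (Sum.inr (Sum.inr (i, j)))).adjugate.mulVec
      fun i => MvPolynomial.X (Sum.inl i)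

lemma eval_genericFacetResultant {n : ℕ} (lam : Fin (n + 1) → ℤ) (m : ℕ) (c : Fin n → ℂ) (a : ℂ)
    (R : Matrix (Fin n) (Fin n) ℂ) :
    MvPolynomial.eval (Sum.elim c (Sum.elim (fun _ => a) (fun ij => R ij.1 ij.2)))
        (genericFacetResultant lam m) =
      facetResultant lam m (Fin.partialSum (R.adjugate.mulVec c)) := by
  rw [genericFacetResultant, facetResultant_map, map_partialSum]
  congr 2
  funext i
  rw [Function.comp_apply, RingHom.map_mulVec, ← RingHom.mapMatrix_apply, RingHom.map_adjugate]
  have hR : (MvPolynomial.eval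
      (Sum.elim c (Sum.elim (fun _ : Unit => a) fun ij => R ij.1 ij.2))).mapMatrix
      (Matrix.of fun i j => MvPolynomial.X (Sum.inr (Sum.inr (i, j)))) = R := by
    ext i j
    simp
  rw [hR]
  exact congrFun (congrArg _ (funext fun j => by simp)) i

lemma genericFacetResultant_ne_zero {n m : ℕ} {lam : Fin (n + 1) → ℤ} (hm : m ≠ 0)
    (hpos : (Finset.univ.filter fun k => lam k = 1).card = m)
    (hneg : (Finset.univ.filter fun k => lam k = -1).card = m) :
    genericFacetResultant lam m ≠ 0 := by
  intro h
  let E : Fin (n + 1) → ℂ := fun k => if lam k = 1 then 0 else 1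
  let d : Fin n → ℂ := fun j => E j.succ - E j.castSucc
  have hd : Fin.partialSum d = fun k => E k + -E 0 := by
    funext k
    rw [(eq_add_partialSum_iff d E).mpr (fun _ => rfl) k]
    ring
  have heval := eval_genericFacetResultant lam m d 1 1
  rw [h, map_zero, Matrix.adjugate_one, Matrix.one_mulVec, hd] at heval
  exact facetResultant_ne_zero hm hpos hneg (-E 0) heval.symm

/-- for even `N ≥ 6` with `N ≡ 2 (mod 4)` and a balanced sign vector
`λ ∈ {−1,1}^N`, there is a nonzero polynomial `p` in `(c, a, R)` such that whenever
`a ≠ 0`, `R` is invertible, and `p(c, a, R) ≠ 0`, the facet subsystem determined by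
`(c, a, R, V(λ))` has exactly `N/2` solutions in `(ℂ∖{0})^n`. -/
theorem facet_subsystem_count_two_mod_four (N : ℕ) (hN : 6 ≤ N) (hmod : N % 4 = 2)
    (lam : Fin N → ℤ) (hlam : ∀ k, lam k = 1 ∨ lam k = -1)
    (hsum : ∑ k, lam k = 0) :
    ∃ p : MvPolynomial (Fin (N - 1) ⊕ Unit ⊕ (Fin (N - 1) × Fin (N - 1))) ℂ, p ≠ 0 ∧
      ∀ (c : Fin (N - 1) → ℂ) (a : ℂ) (R : Matrix (Fin (N - 1)) (Fin (N - 1)) ℂ),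
        a ≠ 0 → IsUnit R →
        MvPolynomial.eval
            (Sum.elim c (Sum.elim (fun _ => a) (fun ij => R ij.1 ij.2))) p ≠ 0 →
        (facetSol N c a R lam).Finite ∧ (facetSol N c a R lam).ncard = N / 2 := by
  obtain ⟨n, rfl⟩ : ∃ n, N = n + 1 := ⟨N - 1, by lia⟩
  obtain ⟨hpos, hneg⟩ := card_filter_sign hlam hsum
  refine ⟨genericFacetResultant lam ((n + 1) / 2),
    genericFacetResultant_ne_zero (by lia) hpos hneg, fun c a R ha hR hp => ?_⟩
  have heval := eval_genericFacetResultant lam ((n + 1) / 2) c a R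
  exact facetSol_finite_and_ncard hlam hpos hneg (Nat.odd_iff.mpr (by lia)) c a R ha
    ((Matrix.isUnit_iff_isUnit_det R).mp hR).ne_zero (heval ▸ hp)
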